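/- arXiv:math/0409275 — 6 statements merged into one kernel-verified Lean document; each statement's English description precedes it below -/
import Mathlib

section
/- If λ →deg μ is a degeneration of Lie algebra laws on ℂⁿ, then the dimension of the derived subalgebra does not increase: dim [μ,μ] ≤ dim [λ,λ], where [λ,λ] denotes the linear span of all values λ(x,y), x,y ∈ ℂⁿ. -/
open Module Submodule Filter Topology

/-- The underlying vector space `ℂⁿ`. -/
abbrev V (n : ℕ) : Type := Fin n → ℂ

/-- A Lie algebra law on `ℂⁿ`: an alternating bilinear map satisfying the Jacobi identity. -/
def IsLieLaw {n : ℕ} (μ : V n → V n → V n) : Prop :=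
  (∀ (a : ℂ) (x y z : V n), μ (a • x + y) z = a • μ x z + μ y z) ∧
  (∀ (a : ℂ) (x y z : V n), μ x (a • y + z) = a • μ x y + μ x z) ∧
  (∀ x : V n, μ x x = 0) ∧
  (∀ x y z : V n, μ x (μ y z) + μ y (μ z x) + μ z (μ x y) = 0)

/-- The base-change action of `GL_n(ℂ)` on laws: `(g·μ)(x,y) = g (μ (g⁻¹ x) (g⁻¹ y))`. -/
noncomputable def act {n : ℕ} (g : V n ≃ₗ[ℂ] V n) (μ : V n → V n → V n) : V n → V n → V n :=
  fun x y => g (μ (g.symm x) (g.symm y))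

/-- The `GL_n(ℂ)`-orbit of a law. -/
def lieOrbit {n : ℕ} (μ : V n → V n → V n) : Set (V n → V n → V n) :=
  {ν | ∃ g : V n ≃ₗ[ℂ] V n, ν = act g μ}

/-- `μ` is a degeneration of `λ` if `μ` lies in the closure of the orbit of `λ`. -/
def Degenerates {n : ℕ} (lam mu : V n → V n → V n) : Prop :=
  mu ∈ closure (lieOrbit lam)

/-- The derived subalgebra `[μ,μ] = span{μ(x,y) : x, y ∈ V}`. -/
noncomputable def derivedSubalgebra {n : ℕ} (μ : V n → V n → V n) : Submodule ℂ (V n) :=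
  Submodule.span ℂ {z | ∃ x y : V n, z = μ x y}

theorem stmt2 (n : ℕ) (lam mu : V n → V n → V n)
    (hlam : IsLieLaw lam) (hmu : IsLieLaw mu) (hdeg : Degenerates lam mu) :
    Module.finrank ℂ (derivedSubalgebra mu) ≤ Module.finrank ℂ (derivedSubalgebra lam) := by
  obtain ⟨b, hbs, hbspan, hbli⟩ := exists_linearIndependent ℂ {z | ∃ x y : V n, z = mu x y}
  have hfin : Finite b := hbli.finite
  have hft : Fintype b := Fintype.ofFinite b
  have hbs2 : ∀ i : b, ∃ x y : V n, (i : V n) = mu x y := fun i => hbs i.2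
  choose X Y hXY using hbs2
  have hcard : Module.finrank ℂ (derivedSubalgebra mu) = Fintype.card b := by
    unfold derivedSubalgebra
    rw [← hbspan, finrank_span_set_eq_card hbli, Set.toFinset_card]
  let F : (V n → V n → V n) → (b → V n) := fun ν i => ν (X i) (Y i)
  have hF : Continuous F := by
    refine continuous_pi fun i => ?_
    exact (continuous_apply (Y i)).comp (continuous_apply (X i))
  have hopen : IsOpen (F ⁻¹' {f : b → V n | LinearIndependent ℂ f}) :=
    isOpen_setOfPred_linearIndependent.preimage hF
  have hmem : mu ∈ F ⁻¹' {f : b → V n | LinearIndependent ℂ f} := by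
    have h : F mu = fun i : b => (i : V n) := by
      funext i
      exact (hXY i).symm
    change LinearIndependent ℂ (F mu)
    rw [h]
    exact hbli
  obtain ⟨ν, hν, g, rfl⟩ := mem_closure_iff.1 hdeg _ hopen hmem
  have hli : LinearIndependent ℂ (F (act g lam)) := hν
  have hli2 : LinearIndependent ℂ
      (fun i : b => lam (g.symm (X i)) (g.symm (Y i))) :=
    LinearIndependent.of_comp (g : V n →ₗ[ℂ] V n) hli
  rw [hcard, ← finrank_span_eq_card hli2]
  apply Submodule.finrank_mono
  apply Submodule.span_mono
  rintro _ ⟨i, rfl⟩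
  exact ⟨_, _, rfl⟩
end

section
/- If λ →deg μ is a degeneration of Lie algebra laws on ℂⁿ, then the dimension of the center does not decrease: dim Z(λ) ≤ dim Z(μ), where Z(λ) = {x ∈ ℂⁿ : λ(x,y) = 0 for all y ∈ ℂⁿ}. -/
open Module Submodule Filter Topology

/-- The center `Z(μ) = {x : μ(x,y) = 0 for all y}` (as a subspace). -/
noncomputable def lawCenter {n : ℕ} (μ : V n → V n → V n) : Submodule ℂ (V n) :=
  Submodule.span ℂ {x | ∀ y : V n, μ x y = 0}

/-- Bilinearity of a law. -/
def IsBilinLaw {n : ℕ} (μ : V n → V n → V n) : Prop :=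
  (∀ (a : ℂ) (x y z : V n), μ (a • x + y) z = a • μ x z + μ y z) ∧
  (∀ (a : ℂ) (x y z : V n), μ x (a • y + z) = a • μ x y + μ x z)

lemma isBilinLaw_act {n : ℕ} {μ : V n → V n → V n} (h : IsBilinLaw μ) (g : V n ≃ₗ[ℂ] V n) :
    IsBilinLaw (act g μ) := by
  constructor
  · intro a x y z
    simp [act, h.1]
  · intro a x y z
    simp [act, h.2]

/-- A bilinear law as a bilinear map. -/
noncomputable def bilinOf {n : ℕ} {μ : V n → V n → V n} (h : IsBilinLaw μ) :
    V n →ₗ[ℂ] V n →ₗ[ℂ] V n :=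
  LinearMap.mk₂ ℂ μ
    (fun x y z => by simpa using h.1 1 x y z)
    (fun a x z => by
      have h0 : μ 0 z = 0 := by simpa using h.1 1 0 0 z
      simpa [h0] using h.1 a x 0 z)
    (fun x y z => by simpa using h.2 1 x y z)
    (fun a x y => by
      have h0 : μ x 0 = 0 := by simpa using h.2 1 x 0 0
      simpa [h0] using h.2 a x y 0)

/-- The map `x ↦ (μ(x, e_j))_j`. -/
noncomputable def adMap {n : ℕ} {μ : V n → V n → V n} (h : IsBilinLaw μ) :
    V n →ₗ[ℂ] (Fin n → V n) :=
  LinearMap.pi fun j => (bilinOf h).flip (Pi.single j 1)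

lemma adMap_apply {n : ℕ} {μ : V n → V n → V n} (h : IsBilinLaw μ) (x : V n) :
    adMap h x = fun j => μ x (Pi.single j 1) := rfl

lemma ker_adMap {n : ℕ} {μ : V n → V n → V n} (h : IsBilinLaw μ) :
    LinearMap.ker (adMap h) = lawCenter μ := by
  have key : ∀ x, x ∈ LinearMap.ker (adMap h) ↔ ∀ y, μ x y = 0 := by
    intro x
    rw [LinearMap.mem_ker]
    constructor
    · intro hx y
      have : bilinOf h x = 0 := by
        apply (Pi.basisFun ℂ (Fin n)).ext
        intro j
        rw [Pi.basisFun_apply]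
        exact congrFun hx j
      exact LinearMap.congr_fun this y
    · intro hx
      rw [adMap_apply]
      funext j
      exact hx _
  have : {x | ∀ y : V n, μ x y = 0} = (LinearMap.ker (adMap h) : Set (V n)) := by
    ext x
    exact (key x).symm
  rw [lawCenter, this, Submodule.span_eq]

lemma finrank_center_act {n : ℕ} (μ : V n → V n → V n) (g : V n ≃ₗ[ℂ] V n) :
    Module.finrank ℂ (lawCenter (act g μ)) = Module.finrank ℂ (lawCenter μ) := by
  have : lawCenter (act g μ) = (lawCenter μ).map (g : V n →ₗ[ℂ] V n) := by
    rw [lawCenter, lawCenter, Submodule.map_span]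
    congr 1
    ext x
    simp only [Set.mem_setOf_eq, Set.mem_image, act]
    constructor
    · intro hx
      refine ⟨g.symm x, fun y => ?_, by simp⟩
      simpa using hx (g y)
    · rintro ⟨z, hz, rfl⟩ y
      simp [hz]
  rw [this]
  exact LinearEquiv.finrank_map_eq g _

theorem stmt3 (n : ℕ) (lam mu : V n → V n → V n)
    (hlam : IsLieLaw lam) (hmu : IsLieLaw mu) (hdeg : Degenerates lam mu) :
    Module.finrank ℂ (lawCenter lam) ≤ Module.finrank ℂ (lawCenter mu) := by
  have bl : IsBilinLaw lam := ⟨hlam.1, hlam.2.1⟩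
  have bm : IsBilinLaw mu := ⟨hmu.1, hmu.2.1⟩
  let c := Module.finBasis ℂ (LinearMap.range (adMap bm))
  have hc : ∀ i, ∃ x, adMap bm x = (c i : Fin n → V n) := fun i => (c i).2
  choose b hb using hc
  let F : (V n → V n → V n) →
      (Fin (Module.finrank ℂ (LinearMap.range (adMap bm))) → Fin n → V n) :=
    fun ν i j => ν (b i) (Pi.single j 1)
  have hF : Continuous F := by fun_prop
  have hopen : IsOpen (F ⁻¹' {f | LinearIndependent ℂ f}) :=
    isOpen_setOfPred_linearIndependent.preimage hF
  have hmem : mu ∈ F ⁻¹' {f | LinearIndependent ℂ f} := by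
    have e : F mu = fun i => (c i : Fin n → V n) := by
      funext i
      rw [← hb i, adMap_apply]
    change LinearIndependent ℂ (F mu)
    rw [e]
    exact c.linearIndependent.map' (Submodule.subtype _) (Submodule.ker_subtype _)
  obtain ⟨ν, hν, g, rfl⟩ := mem_closure_iff.1 hdeg _ hopen hmem
  have ba := isBilinLaw_act bl g
  have hli : LinearIndependent ℂ (fun i => adMap ba (b i)) := hν
  have hli2 : LinearIndependent ℂ (fun i => (adMap ba).rangeRestrict (b i)) :=
    LinearIndependent.of_comp (Submodule.subtype _) hli
  have hle := hli2.fintype_card_le_finrank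
  rw [Fintype.card_fin] at hle
  have r1 := (adMap ba).finrank_range_add_finrank_ker
  have r2 := (adMap bm).finrank_range_add_finrank_ker
  rw [ker_adMap] at r1 r2
  rw [finrank_center_act] at r1
  omega
end

section
/- If λ →deg μ is a degeneration of Lie algebra laws on ℂⁿ, then for every j ≥ 0 the dimensions of the terms of the upper central series do not decrease: dim Z^j(λ) ≤ dim Z^j(μ), where Z^0 = 0 and Z^{j+1}(λ) is the preimage in ℂⁿ of the center of the quotient Lie algebra (ℂⁿ, λ)/Z^j(λ). -/
open Module Submodule Filter Topology

/-- Upper central series: `Z^0 = 0`, `Z^(j+1) = {x : μ(x,y) ∈ Z^j for all y}`. -/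
noncomputable def ucs {n : ℕ} (μ : V n → V n → V n) : ℕ → Submodule ℂ (V n)
  | 0 => ⊥
  | j + 1 => Submodule.span ℂ {x | ∀ y : V n, μ x y ∈ ucs μ j}

/-- Iterated right bracket of `x` with standard basis vectors. -/
noncomputable def iter {n : ℕ} (ν : V n → V n → V n) : List (Fin n) → V n → V n
  | [], x => x
  | i :: l, x => iter ν l (ν x (Pi.single i 1))

/-- Bilinearity. -/
def IsBil {n : ℕ} (μ : V n → V n → V n) : Prop :=
  (∀ (a : ℂ) (x y z : V n), μ (a • x + y) z = a • μ x z + μ y z) ∧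
  (∀ (a : ℂ) (x y z : V n), μ x (a • y + z) = a • μ x y + μ x z)

/-- A bilinear law with the second argument fixed. -/
noncomputable def leftLin {n : ℕ} {μ : V n → V n → V n} (h : IsBil μ) (z : V n) :
    V n →ₗ[ℂ] V n :=
  IsLinearMap.mk' (fun x => μ x z)
    { map_add := fun x y => by simpa using h.1 1 x y z
      map_smul := fun a x => by
        have h0 : μ 0 z = 0 := by simpa using h.1 1 0 0 z
        simpa [h0] using h.1 a x 0 z }

/-- A bilinear law with the first argument fixed. -/
noncomputable def rightLin {n : ℕ} {μ : V n → V n → V n} (h : IsBil μ) (z : V n) :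
    V n →ₗ[ℂ] V n :=
  IsLinearMap.mk' (fun x => μ z x)
    { map_add := fun x y => by simpa using h.2 1 z x y
      map_smul := fun a x => by
        have h0 : μ z 0 = 0 := by simpa using h.2 1 z 0 0
        simpa [h0] using h.2 a z x 0 }

lemma expand {n : ℕ} (f : V n →ₗ[ℂ] V n) (x : V n) :
    f x = ∑ k, x k • f (Pi.single k 1) := by
  conv_lhs => rw [pi_eq_sum_univ' x]
  rw [map_sum]
  refine Finset.sum_congr rfl fun k _ => ?_
  rw [map_smul]

lemma expandL {n : ℕ} {μ : V n → V n → V n} (h : IsBil μ) (x z : V n) :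
    μ x z = ∑ k, x k • μ (Pi.single k 1) z := expand (leftLin h z) x

lemma expandR {n : ℕ} {μ : V n → V n → V n} (h : IsBil μ) (x z : V n) :
    μ z x = ∑ k, x k • μ z (Pi.single k 1) := expand (rightLin h z) x

/-- `iter` as a linear map. -/
noncomputable def iterLin {n : ℕ} {μ : V n → V n → V n} (h : IsBil μ) :
    List (Fin n) → (V n →ₗ[ℂ] V n)
  | [] => LinearMap.id
  | i :: l => (iterLin h l).comp (leftLin h (Pi.single i 1))

lemma iterLin_apply {n : ℕ} {μ : V n → V n → V n} (h : IsBil μ) (l : List (Fin n)) :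
    ∀ x, iterLin h l x = iter μ l x := by
  induction l with
  | nil => intro x; rfl
  | cons i l ih => intro x; exact ih _

/-- All iterated brackets of length `j`. -/
noncomputable def T {n : ℕ} {μ : V n → V n → V n} (h : IsBil μ) (j : ℕ) :
    V n →ₗ[ℂ] (List.Vector (Fin n) j → V n) :=
  LinearMap.pi fun l => iterLin h l.1

lemma mem_ucs_succ {n : ℕ} {μ : V n → V n → V n} (h : IsBil μ) (j : ℕ) (x : V n) :
    x ∈ ucs μ (j + 1) ↔ ∀ y, μ x y ∈ ucs μ j := by
  rw [ucs]
  let S : Submodule ℂ (V n) := ⨅ y, (ucs μ j).comap (leftLin h y)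
  have hS : {x | ∀ y : V n, μ x y ∈ ucs μ j} = (S : Set (V n)) := by
    ext x
    simp [S, leftLin]
  rw [hS, Submodule.span_eq, ← SetLike.mem_coe, ← hS]
  rfl

lemma mem_ucs {n : ℕ} {μ : V n → V n → V n} (h : IsBil μ) (j : ℕ) : ∀ x : V n,
    x ∈ ucs μ j ↔ ∀ l : List (Fin n), l.length = j → iter μ l x = 0 := by
  induction j with
  | zero =>
    intro x
    simp [ucs, iter]
  | succ j ih =>
    intro x
    rw [mem_ucs_succ h]
    constructor
    · intro hx l hl
      cases l with
      | nil => simp at hl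
      | cons i l => exact (ih _).1 (hx _) l (by simpa using hl)
    · intro hx y
      rw [expandR h]
      refine Submodule.sum_mem _ fun k _ => Submodule.smul_mem _ _ ?_
      rw [ih]
      intro l hl
      exact hx (k :: l) (by simpa using hl)

lemma ucs_eq_ker {n : ℕ} {μ : V n → V n → V n} (h : IsBil μ) (j : ℕ) :
    ucs μ j = LinearMap.ker (T h j) := by
  ext x
  rw [mem_ucs h, LinearMap.mem_ker, funext_iff]
  constructor
  · intro hx l
    exact (iterLin_apply h l.1 x).trans (hx l.1 l.2)
  · intro hx l hl
    exact (iterLin_apply h l x).symm.trans (hx ⟨l, hl⟩)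

lemma act_bil {n : ℕ} {μ : V n → V n → V n} (h : IsBil μ) (g : V n ≃ₗ[ℂ] V n) :
    IsBil (act g μ) := by
  constructor
  · intro a x y z
    simp [act, h.1]
  · intro a x y z
    simp [act, h.2]

lemma ucs_act {n : ℕ} {μ : V n → V n → V n} (h : IsBil μ) (g : V n ≃ₗ[ℂ] V n) (j : ℕ) :
    ∀ x, g x ∈ ucs (act g μ) j ↔ x ∈ ucs μ j := by
  induction j with
  | zero => intro x; simp [ucs]
  | succ j ih =>
    intro x
    rw [mem_ucs_succ h, mem_ucs_succ (act_bil h g)]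
    constructor
    · intro hx y
      rw [← ih]
      simpa [act] using hx (g y)
    · intro hx y
      have := (ih _).2 (hx (g.symm y))
      simpa [act] using this

lemma finrank_ucs_act {n : ℕ} {μ : V n → V n → V n} (h : IsBil μ) (g : V n ≃ₗ[ℂ] V n)
    (j : ℕ) : finrank ℂ (ucs (act g μ) j) = finrank ℂ (ucs μ j) := by
  have : ucs (act g μ) j = (ucs μ j).map (g : V n →ₗ[ℂ] V n) := by
    ext x
    obtain ⟨y, rfl⟩ := g.surjective x
    rw [ucs_act h]
    simp
  rw [this]
  exact LinearEquiv.finrank_map_eq g _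

lemma tendsto_iter {n : ℕ} {mu : V n → V n → V n} (hmu : IsBil mu)
    {F : Filter (V n → V n → V n)} (hF : F ≤ 𝓝 mu) (hb : ∀ᶠ ν in F, IsBil ν)
    (l : List (Fin n)) : ∀ (X : (V n → V n → V n) → V n) (x : V n), Tendsto X F (𝓝 x) →
      Tendsto (fun ν => iter ν l (X ν)) F (𝓝 (iter mu l x)) := by
  induction l with
  | nil => intro X x hX; exact hX
  | cons i l ih =>
    intro X x hX
    refine ih (fun ν => ν (X ν) (Pi.single i 1)) _ ?_
    rw [expandL hmu]
    have : Tendsto (fun ν : V n → V n → V n =>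
        ∑ k, X ν k • ν (Pi.single k 1) (Pi.single i 1)) F
        (𝓝 (∑ k, x k • mu (Pi.single k 1) (Pi.single i 1))) := by
      refine tendsto_finsetSum _ fun k _ => ?_
      refine (((continuous_apply k).tendsto x).comp hX).smul ?_
      have hc : Continuous fun ν : V n → V n → V n => ν (Pi.single k 1) (Pi.single i 1) := by
        fun_prop
      exact (hc.tendsto mu).mono_left hF
    refine this.congr' ?_
    filter_upwards [hb] with ν hν
    exact (expandL hν _ _).symm

theorem stmt4 (n : ℕ) (lam mu : V n → V n → V n)
    (hlam : IsLieLaw lam) (hmu : IsLieLaw mu) (hdeg : Degenerates lam mu) :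
    ∀ j : ℕ, Module.finrank ℂ (ucs lam j) ≤ Module.finrank ℂ (ucs mu j) := by
  intro j
  have hl : IsBil lam := ⟨hlam.1, hlam.2.1⟩
  have hm : IsBil mu := ⟨hmu.1, hmu.2.1⟩
  have hne : (𝓝[lieOrbit lam] mu).NeBot := mem_closure_iff_nhdsWithin_neBot.1 hdeg
  have horb : ∀ᶠ ν in 𝓝[lieOrbit lam] mu, ν ∈ lieOrbit lam := self_mem_nhdsWithin
  have hb : ∀ᶠ ν in 𝓝[lieOrbit lam] mu, IsBil ν := by
    filter_upwards [horb] with ν hν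
    obtain ⟨g, rfl⟩ := hν
    exact act_bil hl g
  -- a basis of the range of `T mu`
  let b := Module.finBasis ℂ (LinearMap.range (T hm j))
  choose x hx using fun i => (b i).2
  have hli : LinearIndependent ℂ (fun i l => iter mu (l : List.Vector (Fin n) j).1 (x i)) := by
    have h1 := b.linearIndependent.map' (Submodule.subtype _) (Submodule.ker_subtype _)
    have he : (fun i l => iter mu (l : List.Vector (Fin n) j).1 (x i)) =
        (Submodule.subtype _) ∘ b := by
      funext i
      refine Eq.trans ?_ (hx i)
      funext l
      exact (iterLin_apply hm _ _).symm
    rw [he]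
    exact h1
  have ht : Tendsto (fun ν i l => iter ν (l : List.Vector (Fin n) j).1 (x i))
      (𝓝[lieOrbit lam] mu) (𝓝 (fun i l => iter mu (l : List.Vector (Fin n) j).1 (x i))) := by
    rw [tendsto_pi_nhds]
    intro i
    rw [tendsto_pi_nhds]
    intro l
    exact tendsto_iter hm nhdsWithin_le_nhds hb l.1 (fun _ => x i) _ tendsto_const_nhds
  have hev := ht.eventually hli.eventually
  obtain ⟨ν, hν, g, rfl⟩ := (hev.and horb).exists
  have hg := act_bil hl g
  rw [← finrank_ucs_act hl g j, ucs_eq_ker hg, ucs_eq_ker hm]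
  have e1 := LinearMap.finrank_range_add_finrank_ker (T hg j)
  have e2 := LinearMap.finrank_range_add_finrank_ker (T hm j)
  have hle : finrank ℂ (LinearMap.range (T hm j)) ≤ finrank ℂ (LinearMap.range (T hg j)) := by
    have h2 : LinearIndependent ℂ (fun i => (T hg j).rangeRestrict (x i)) := by
      refine LinearIndependent.of_comp (Submodule.subtype _) ?_
      have he : (Submodule.subtype _) ∘ (fun i => (T hg j).rangeRestrict (x i)) =
          (fun i l => iter (act g lam) (l : List.Vector (Fin n) j).1 (x i)) := by
        funext i l
        exact iterLin_apply hg _ _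
      rw [he]
      exact hν
    simpa using h2.fintype_card_le_finrank
  omega
end

section
/- The nilpotency class does not increase under degeneration: if λ →deg μ is a degeneration of Lie algebra laws on ℂⁿ and the lower central series of λ satisfies C^c(λ) = 0 (so λ is nilpotent of class at most c), then also C^c(μ) = 0, i.e. μ is nilpotent of class at most c. -/
open Module Submodule Filter Topology

/-- Lower central series: `C^0 = V`, `C^(k+1) = span{μ(x,y) : x ∈ V, y ∈ C^k}`. -/
noncomputable def lcs {n : ℕ} (μ : V n → V n → V n) : ℕ → Submodule ℂ (V n)
  | 0 => ⊤
  | k + 1 => Submodule.span ℂ {z | ∃ x : V n, ∃ y ∈ lcs μ k, z = μ x y}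

/-- Linearity in the second argument. -/
def RLin {n : ℕ} (ν : V n → V n → V n) : Prop :=
  ∀ (a : ℂ) (x y z : V n), ν x (a • y + z) = a • ν x y + ν x z

/-- The left multiplication by `x` as a linear map. -/
def rlinMap {n : ℕ} (ν : V n → V n → V n) (h : RLin ν) (x : V n) : V n →ₗ[ℂ] V n :=
  IsLinearMap.mk' (ν x) (by
    have h0 : ν x 0 = 0 := by
      have := h 1 x 0 0
      simpa using this
    constructor
    · intro y z
      have := h 1 x y z
      simpa using this
    · intro a y
      have := h a x y 0
      simpa [h0] using this)

/-- Iterated bracket. -/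
def brk {n : ℕ} (ν : V n → V n → V n) (y : V n) : List (V n) → V n
  | [] => y
  | x :: l => ν x (brk ν y l)

/-- Iterated bracket, expanded in the standard basis (continuous in `ν`). -/
def wrd {n : ℕ} (ν : V n → V n → V n) (y : V n) : List (V n) → V n
  | [] => y
  | x :: l => ∑ j, wrd ν y l j • ν x (Pi.single j 1)

lemma wrd_eq_brk {n : ℕ} (ν : V n → V n → V n) (h : RLin ν) (y : V n) (l : List (V n)) :
    wrd ν y l = brk ν y l := by
  induction l with
  | nil => rfl
  | cons x l ih =>
    simp only [wrd, brk, ih]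
    have := (rlinMap ν h x).pi_apply_eq_sum_univ (brk ν y l)
    refine Eq.trans ?_ this.symm
    refine Finset.sum_congr rfl fun j _ => ?_
    congr 1
    change ν x _ = ν x _
    congr 1
    funext i
    simp [Pi.single_apply, eq_comm]

lemma continuous_wrd {n : ℕ} (y : V n) (l : List (V n)) :
    Continuous (fun ν : V n → V n → V n => wrd ν y l) := by
  induction l with
  | nil => exact continuous_const
  | cons x l ih =>
    simp only [wrd]
    refine continuous_finset_sum _ fun j _ => ?_
    exact ((continuous_apply j).comp ih).smul
      ((continuous_apply (Pi.single j 1)).comp (continuous_apply x))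

lemma brk_act {n : ℕ} (g : V n ≃ₗ[ℂ] V n) (ν : V n → V n → V n) (y : V n) (l : List (V n)) :
    brk (act g ν) y l = g (brk ν (g.symm y) (l.map g.symm)) := by
  induction l with
  | nil => simp [brk]
  | cons x l ih => simp [brk, ih, act]

lemma RLin.act {n : ℕ} (g : V n ≃ₗ[ℂ] V n) {ν : V n → V n → V n} (h : RLin ν) :
    RLin (act g ν) := by
  intro a x y z
  simp only [_root_.act, map_add, map_smul]
  rw [h, map_add, map_smul]

lemma brk_mem_lcs {n : ℕ} (ν : V n → V n → V n) (y : V n) (l : List (V n)) :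
    brk ν y l ∈ lcs ν l.length := by
  induction l with
  | nil => simp [lcs]
  | cons x l ih => exact Submodule.subset_span ⟨x, _, ih, rfl⟩

lemma lcs_le {n : ℕ} (ν : V n → V n → V n) (h : RLin ν) (k : ℕ) :
    lcs ν k ≤ Submodule.span ℂ {z | ∃ y l, l.length = k ∧ z = brk ν y l} := by
  induction k with
  | zero => exact fun z _ => Submodule.subset_span ⟨z, [], rfl, rfl⟩
  | succ k ih =>
    refine Submodule.span_le.2 ?_
    rintro _ ⟨x, y, hy, rfl⟩
    have key : Submodule.span ℂ {z | ∃ y l, l.length = k ∧ z = brk ν y l} ≤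
        (Submodule.span ℂ {z | ∃ y l, l.length = k + 1 ∧ z = brk ν y l}).comap
          (rlinMap ν h x) := by
      refine Submodule.span_le.2 ?_
      rintro _ ⟨y, l, hl, rfl⟩
      exact Submodule.subset_span ⟨y, x :: l, by simp [hl], rfl⟩
    exact key (ih hy)

theorem stmt6 (n c : ℕ) (lam mu : V n → V n → V n)
    (hlam : IsLieLaw lam) (hmu : IsLieLaw mu) (hdeg : Degenerates lam mu)
    (hnil : lcs lam c = ⊥) :
    lcs mu c = ⊥ := by
  have hR : RLin lam := hlam.2.1
  have hM : RLin mu := hmu.2.1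
  have hz : ∀ (y : V n) (l : List (V n)), l.length = c → brk mu y l = 0 := by
    intro y l hl
    rw [← wrd_eq_brk mu hM]
    have hcl : IsClosed {ν : V n → V n → V n | wrd ν y l = 0} :=
      isClosed_singleton.preimage (continuous_wrd y l)
    refine closure_minimal ?_ hcl hdeg
    rintro _ ⟨g, rfl⟩
    change wrd _ y l = 0
    rw [wrd_eq_brk _ (hR.act g), brk_act]
    have := brk_mem_lcs lam (g.symm y) (l.map g.symm)
    rw [List.length_map, hl, hnil, Submodule.mem_bot] at this
    rw [this, map_zero]
  refine le_bot_iff.1 ((lcs_le mu hM c).trans (Submodule.span_le.2 ?_))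
  rintro _ ⟨y, l, hl, rfl⟩
  simpa using hz y l hl
end

section
/- Every nilpotent Lie algebra law on ℂ⁴ lies in the closure of the GL_4(ℂ)-orbit of the standard graded filiform law 𝔫₄; that is, 𝒩₄(ℂ) = closure(O(𝔫₄(ℂ))), where 𝔫₄ is defined on a basis (e₁,…,e₄) by [e₁,e₂] = e₃, [e₁,e₃] = e₄ (all other basis brackets zero). Moreover this closure is exactly O(𝔫₄) ∪ O(𝔫₃⊕ℂ) ∪ O(ℂ⁴), i.e. every nilpotent law on ℂ⁴ is isomorphic to 𝔫₄, to 𝔫₃⊕ℂ, or to the abelian law. -/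
open Module Submodule Filter Topology

/-- A law is nilpotent if its lower central series terminates in `0`. -/
noncomputable def IsNilpotentLaw {n : ℕ} (μ : V n → V n → V n) : Prop :=
  ∃ k : ℕ, lcs μ k = ⊥

/-- The law `𝔫₄` on `ℂ⁴`: `[e₁,e₂] = e₃`, `[e₁,e₃] = e₄`. -/
noncomputable def n4Law : V 4 → V 4 → V 4 := fun x y =>
  ![0, 0, x 0 * y 1 - x 1 * y 0, x 0 * y 2 - x 2 * y 0]

/-- The law `𝔫₃ ⊕ ℂ` on `ℂ⁴`: `[e₁,e₂] = e₃`. -/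
noncomputable def n3CLaw : V 4 → V 4 → V 4 := fun x y =>
  ![0, 0, x 0 * y 1 - x 1 * y 0, 0]

/-- Bundled bilinear map attached to a Lie law. -/
noncomputable def lawBil (μ : V 4 → V 4 → V 4) (h : IsLieLaw μ) : V 4 →ₗ[ℂ] V 4 →ₗ[ℂ] V 4 :=
  have hz1 : ∀ z, μ 0 z = 0 := fun z => by
    have := h.1 1 0 0 z
    simpa using this
  have hz2 : ∀ z, μ z 0 = 0 := fun z => by
    have := h.2.1 1 z 0 0
    simpa using this
  LinearMap.mk₂ ℂ μ
    (fun x y z => by simpa using h.1 1 x y z)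
    (fun c x y => by simpa [hz1] using h.1 c x 0 y)
    (fun x y z => by simpa using h.2.1 1 x y z)
    (fun c x y => by simpa [hz2] using h.2.1 c x y 0)

theorem lawBil_apply (μ : V 4 → V 4 → V 4) (h : IsLieLaw μ) (x y : V 4) :
    lawBil μ h x y = μ x y := rfl

/-- The family of laws interpolating between the three types. -/
noncomputable def fam (s t : ℂ) : V 4 → V 4 → V 4 := fun x y =>
  ![0, 0, s * (x 0 * y 1 - x 1 * y 0), t * (x 0 * y 2 - x 2 * y 0)]

theorem n4_eq : n4Law = fam 1 1 := by funext x y; simp [n4Law, fam]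
theorem n3_eq : n3CLaw = fam 1 0 := by funext x y; simp [n3CLaw, fam]
theorem zero_eq : (fun _ _ => (0 : V 4)) = fam 0 0 := by
  funext x y; ext i; fin_cases i <;> simp [fam]

theorem fam_lie (s t : ℂ) : IsLieLaw (fam s t) := by
  refine ⟨?_, ?_, ?_, ?_⟩
  · intro a x y z; ext i; fin_cases i <;> simp [fam] <;> ring
  · intro a x y z; ext i; fin_cases i <;> simp [fam] <;> ring
  · intro x; ext i; fin_cases i <;> simp [fam, mul_comm]
  · intro x y z; ext i; fin_cases i <;> simp [fam] <;> ring

theorem orbit_lemma (B : V 4 →ₗ[ℂ] V 4 →ₗ[ℂ] V 4) (halt : ∀ x, B x x = 0) (s : ℂ)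
    (e1 e2 e3 e4 : V 4) (hli : LinearIndependent ℂ ![e1, e2, e3, e4])
    (h12 : B e1 e2 = e3) (h13 : B e1 e3 = s • e4) (h14 : B e1 e4 = 0)
    (h23 : B e2 e3 = 0) (h24 : B e2 e4 = 0) (h34 : B e3 e4 = 0) :
    (fun x y => B x y) ∈ lieOrbit (fam 1 s) := by
  have hanti : ∀ x y, B y x = - B x y := fun x y => by
    have h := halt (x + y)
    simp only [map_add, LinearMap.add_apply, halt, zero_add, add_zero] at h
    exact eq_neg_of_add_eq_zero_left h
  let b : Basis (Fin 4) ℂ (V 4) := basisOfLinearIndependentOfCardEqFinrank hli (by simp)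
  have hb : ⇑b = ![e1, e2, e3, e4] := by simp [b]
  refine ⟨b.equivFun.symm, ?_⟩
  funext x y
  have key : ∀ c d : V 4, B (b.equivFun.symm c) (b.equivFun.symm d)
      = b.equivFun.symm (fam 1 s c d) := by
    intro c d
    simp only [Basis.equivFun_symm_apply, Fin.sum_univ_four, hb]
    simp [fam, hanti e1 e2, hanti e1 e3, hanti e1 e4, hanti e2 e3, hanti e2 e4, hanti e3 e4,
      h12, h13, h14, h23, h24, h34, halt]
    module
  have := key (b.equivFun x) (b.equivFun y)
  simpa [act] using this

theorem act_mem {μ ν : V 4 → V 4 → V 4} (g : V 4 ≃ₗ[ℂ] V 4) (h : ν ∈ lieOrbit μ) :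
    act g ν ∈ lieOrbit μ := by
  obtain ⟨k, rfl⟩ := h
  exact ⟨k.trans g, by funext x y; simp [act]⟩

theorem fam_mem (s t : ℂ) (hs : s ≠ 0) (ht : t ≠ 0) : fam s t ∈ lieOrbit n4Law := by
  rw [n4_eq]
  refine orbit_lemma (lawBil (fam s t) (fam_lie s t)) (fun x => (fam_lie s t).2.2.1 x) 1
    ![1,0,0,0] ![0,1,0,0] ![0,0,s,0] ![0,0,0,s*t] ?_ ?_ ?_ ?_ ?_ ?_ ?_
  · rw [Fintype.linearIndependent_iff]
    intro g hg
    have h0 := congrFun hg 0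
    have h1 := congrFun hg 1
    have h2 := congrFun hg 2
    have h3 := congrFun hg 3
    simp [Fin.sum_univ_four, hs, ht] at h0 h1 h2 h3
    intro i; fin_cases i <;> simp [*]
  all_goals
    rw [lawBil_apply]; ext i; fin_cases i <;> simp [fam]
  ring

theorem fam_cont (g : V 4 ≃ₗ[ℂ] V 4) (s : ℂ → ℂ) (hs : Continuous s) :
    Continuous (fun u : ℂ => act g (fam (s u) u)) := by
  refine continuous_pi fun x => continuous_pi fun y => ?_
  have hg : Continuous g := g.toLinearMap.continuous_of_finiteDimensional
  refine hg.comp ?_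
  refine continuous_pi fun i => ?_
  fin_cases i <;> simp [fam] <;> fun_prop

theorem lim_mem (g : V 4 ≃ₗ[ℂ] V 4) (s : ℂ → ℂ) (hs : Continuous s)
    (h0 : ∀ u, u ≠ 0 → s u ≠ 0) : act g (fam (s 0) 0) ∈ closure (lieOrbit n4Law) := by
  have h1 : Tendsto (fun u : ℂ => act g (fam (s u) u)) (𝓝[≠] 0) (𝓝 (act g (fam (s 0) 0))) :=
    ((fam_cont g s hs).tendsto 0).mono_left nhdsWithin_le_nhds
  refine mem_closure_of_tendsto h1 ?_
  filter_upwards [self_mem_nhdsWithin] with u hu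
  exact act_mem g (fam_mem _ _ (h0 u hu) hu)

theorem orbits_sub : lieOrbit n4Law ∪ lieOrbit n3CLaw ∪ lieOrbit (fun _ _ => (0 : V 4))
    ⊆ closure (lieOrbit n4Law) := by
  rintro ν ((h | ⟨g, rfl⟩) | ⟨g, rfl⟩)
  · exact subset_closure h
  · rw [n3_eq]
    exact lim_mem g (fun _ => 1) continuous_const (by simp)
  · rw [zero_eq]
    exact lim_mem g id continuous_id (by simp)

/-- The second-argument linear extension of a map, continuous in the map. -/
noncomputable def ext2 (μ : V 4 → V 4 → V 4) (x w : V 4) : V 4 :=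
  ∑ i, w i • μ x (Pi.single i 1)

theorem ext2_eq (μ : V 4 → V 4 → V 4)
    (h1 : ∀ (a : ℂ) (x y z : V 4), μ x (a • y + z) = a • μ x y + μ x z) (x w : V 4) :
    ext2 μ x w = μ x w := by
  have hz : μ x 0 = 0 := by simpa using h1 1 x 0 0
  let f : V 4 →ₗ[ℂ] V 4 :=
    { toFun := μ x
      map_add' := fun y z => by simpa using h1 1 x y z
      map_smul' := fun c y => by simpa [hz] using h1 c x y 0 }
  have := (LinearMap.pi_apply_eq_sum_univ f w)
  change f w = ∑ i, w i • f _ at this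
  change ∑ i, w i • f _ = f w
  rw [this]
  refine Finset.sum_congr rfl fun i _ => ?_
  congr 2
  funext j
  simp [Pi.single_apply, eq_comm]

theorem ext2_cont (x : V 4) (F : (V 4 → V 4 → V 4) → V 4) (hF : Continuous F) :
    Continuous (fun μ : V 4 → V 4 → V 4 => ext2 μ x (F μ)) := by
  unfold ext2
  fun_prop

/-- Closed set of laws of nilpotency class at most three. -/
def goodSet : Set (V 4 → V 4 → V 4) :=
  {μ | (∀ (a : ℂ) (x y z : V 4), μ (a • x + y) z = a • μ x z + μ y z) ∧
  (∀ (a : ℂ) (x y z : V 4), μ x (a • y + z) = a • μ x y + μ x z) ∧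
  (∀ x : V 4, μ x x = 0) ∧
  (∀ x y z : V 4, ext2 μ x (μ y z) + ext2 μ y (μ z x) + ext2 μ z (μ x y) = 0) ∧
  (∀ x y z w : V 4, ext2 μ x (ext2 μ y (μ z w)) = 0)}

theorem goodSet_closed : IsClosed goodSet := by
  have hc : ∀ x y : V 4, Continuous (fun μ : V 4 → V 4 → V 4 => μ x y) := fun x y => by fun_prop
  unfold goodSet
  simp only [Set.ofPred_and, Set.ofPred_forall]
  refine IsClosed.inter ?_ (IsClosed.inter ?_ (IsClosed.inter ?_ (IsClosed.inter ?_ ?_)))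
  · refine isClosed_iInter fun a => isClosed_iInter fun x => isClosed_iInter fun y =>
      isClosed_iInter fun z => isClosed_eq ?_ ?_ <;> fun_prop
  · refine isClosed_iInter fun a => isClosed_iInter fun x => isClosed_iInter fun y =>
      isClosed_iInter fun z => isClosed_eq ?_ ?_ <;> fun_prop
  · refine isClosed_iInter fun x => isClosed_eq ?_ ?_ <;> fun_prop
  · refine isClosed_iInter fun x => isClosed_iInter fun y =>
      isClosed_iInter fun z => isClosed_eq ?_ continuous_const
    exact ((ext2_cont _ _ (hc _ _)).add (ext2_cont _ _ (hc _ _))).add (ext2_cont _ _ (hc _ _))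
  · refine isClosed_iInter fun x => isClosed_iInter fun y =>
      isClosed_iInter fun z => isClosed_iInter fun w => isClosed_eq ?_ continuous_const
    exact ext2_cont _ _ (ext2_cont _ _ (hc _ _))

theorem act_lie {μ : V 4 → V 4 → V 4} (h : IsLieLaw μ) (g : V 4 ≃ₗ[ℂ] V 4) :
    IsLieLaw (act g μ) := by
  obtain ⟨h1, h2, h3, h4⟩ := h
  refine ⟨?_, ?_, ?_, ?_⟩
  · intro a x y z; simp [act, h1]
  · intro a x y z; simp [act, h2]
  · intro x; simp [act, h3]
  · intro x y z
    simp only [act, LinearEquiv.symm_apply_apply, ← map_add, h4, map_zero]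

theorem orbit_good : lieOrbit n4Law ⊆ goodSet := by
  rintro ν ⟨g, rfl⟩
  have hl : IsLieLaw (act g n4Law) := by
    rw [n4_eq]; exact act_lie (fam_lie 1 1) g
  obtain ⟨h1, h2, h3, h4⟩ := hl
  refine ⟨h1, h2, h3, ?_, ?_⟩
  · intro x y z; simp only [ext2_eq _ h2]; exact h4 x y z
  · intro x y z w; simp only [ext2_eq _ h2]
    simp only [act, LinearEquiv.symm_apply_apply]
    rw [LinearEquiv.map_eq_zero_iff]
    ext i; fin_cases i <;> simp [n4Law]

theorem good_nilp : goodSet ⊆ {μ : V 4 → V 4 → V 4 | IsLieLaw μ ∧ IsNilpotentLaw μ} := by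
  rintro μ ⟨h1, h2, h3, h4, h5⟩
  simp only [ext2_eq _ h2] at h4 h5
  have hl : IsLieLaw μ := ⟨h1, h2, h3, h4⟩
  refine ⟨hl, 3, ?_⟩
  have e : ∀ x y, μ x y = lawBil μ hl x y := fun _ _ => rfl
  have a1 : ∀ y ∈ lcs μ 1, ∀ x z, μ z (μ x y) = 0 := by
    intro y hy
    refine Submodule.span_induction ?_ ?_ ?_ ?_ hy
    · rintro _ ⟨x, y, -, rfl⟩ p q; exact h5 _ _ _ _
    · simp [e]
    · intro p q _ _ hp hq x z
      simp only [e, map_add] at *; rw [hp, hq, add_zero]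
    · intro c p _ hp x z
      simp only [e, map_smul] at *; rw [hp, smul_zero]
  have a2 : ∀ y ∈ lcs μ 2, ∀ z, μ z y = 0 := by
    intro y hy
    refine Submodule.span_induction ?_ ?_ ?_ ?_ hy
    · rintro _ ⟨x, y, hy, rfl⟩ p; exact a1 _ hy _ _
    · simp [e]
    · intro p q _ _ hp hq z
      simp only [e, map_add] at *; rw [hp, hq, add_zero]
    · intro c p _ hp z
      simp only [e, map_smul] at *; rw [hp, smul_zero]
  rw [eq_bot_iff]
  change Submodule.span ℂ _ ≤ _
  rw [Submodule.span_le]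
  rintro _ ⟨x, y, hy, rfl⟩
  simpa using a2 y hy x

theorem ad_nilp (μ : V 4 → V 4 → V 4) (hl : IsLieLaw μ) (hn : IsNilpotentLaw μ) (x : V 4) :
    IsNilpotent (lawBil μ hl x) := by
  obtain ⟨k, hk⟩ := hn
  refine ⟨k, ?_⟩
  have : ∀ j v, ((lawBil μ hl x) ^ j) v ∈ lcs μ j := by
    intro j
    induction j with
    | zero => intro v; simp [lcs]
    | succ j ih =>
      intro v
      rw [pow_succ', Module.End.mul_apply]
      exact Submodule.subset_span ⟨x, _, ih v, rfl⟩
  refine LinearMap.ext fun v => ?_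
  have h := this k v
  rw [hk, Submodule.mem_bot] at h
  exact h

theorem nilp_eig {N : V 4 →ₗ[ℂ] V 4} (h : IsNilpotent N) {w : V 4} {c : ℂ} (hw : w ≠ 0)
    (he : N w = c • w) : c = 0 := by
  obtain ⟨k, hk⟩ := h
  have : ∀ j, (N ^ j) w = c ^ j • w := by
    intro j
    induction j with
    | zero => simp
    | succ j ih => rw [pow_succ', Module.End.mul_apply, ih, map_smul, he, smul_smul, pow_succ]
  have h1 := this k
  rw [hk] at h1
  have h2 : c ^ k = 0 := by
    by_contra hc
    exact (smul_ne_zero hc hw) h1.symm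
  exact eq_zero_of_pow_eq_zero h2

theorem nilp_vec {N : V 4 →ₗ[ℂ] V 4} (h : IsNilpotent N) (h2 : ∃ v, N (N v) ≠ 0) :
    ∃ y, N (N y) ≠ 0 ∧ N (N (N y)) = 0 := by
  by_contra! hcon
  obtain ⟨v, hv⟩ := h2
  obtain ⟨k, hk⟩ := h
  have : ∀ j, N (N ((N ^ j) v)) ≠ 0 := by
    intro j
    induction j with
    | zero => simpa using hv
    | succ j ih =>
      rw [pow_succ', Module.End.mul_apply]
      exact hcon _ ih
  apply this k
  rw [hk]; simp

theorem case_one (B : V 4 →ₗ[ℂ] V 4 →ₗ[ℂ] V 4) (halt : ∀ x, B x x = 0)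
    (hj : ∀ x y z, B x (B y z) + B y (B z x) + B z (B x y) = 0)
    (hn : ∀ x, IsNilpotent (B x)) (x : V 4) (hx : ∃ v, B x (B x v) ≠ 0) :
    (fun x y => B x y) ∈ lieOrbit (fam 1 1) := by
  have hanti : ∀ x y, B y x = - B x y := fun x y => by
    have h := halt (x + y)
    simp only [map_add, LinearMap.add_apply, halt, zero_add, add_zero] at h
    exact eq_neg_of_add_eq_zero_left h
  obtain ⟨y, hy2, hy3⟩ := nilp_vec (hn x) hx
  have hx0 : x ≠ 0 := by rintro rfl; simp at hy2
  obtain ⟨e3, h3⟩ : ∃ e3, B x y = e3 := ⟨_, rfl⟩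
  obtain ⟨e4, h4⟩ : ∃ e4, B x e3 = e4 := ⟨_, rfl⟩
  rw [h3, h4] at hy2 hy3
  have hli' : ∀ a b c d : ℂ, a • x + b • y + c • e3 + d • e4 = 0 →
      a = 0 ∧ b = 0 ∧ c = 0 ∧ d = 0 := by
    intro a b c d h
    have hb := congrArg (fun v => B x (B x v)) h
    simp [halt, h3, h4, hy3, hy2] at hb
    subst hb
    have hc := congrArg (fun v => B x v) h
    simp [halt, h3, h4, hy3, hy2] at hc
    subst hc
    have hd : B (d • e3) x = a • x := by
      rw [hanti x, map_smul, h4]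
      simp at h
      exact (eq_neg_of_add_eq_zero_left h).symm
    have ha := nilp_eig (hn _) hx0 hd
    subst ha
    simpa [hy2] using h
  have mk : ∀ y', (∀ a b c d : ℂ, a • x + b • y' + c • e3 + d • e4 = 0 →
      a = 0 ∧ b = 0 ∧ c = 0 ∧ d = 0) → LinearIndependent ℂ ![x, y', e3, e4] := by
    intro y' h
    rw [Fintype.linearIndependent_iff]
    intro g hg
    simp [Fin.sum_univ_four] at hg
    obtain ⟨h0, h1, h2, h3⟩ := h _ _ _ _ hg
    intro i; fin_cases i <;> assumption
  let bb : Basis (Fin 4) ℂ (V 4) :=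
    basisOfLinearIndependentOfCardEqFinrank (mk y hli') (by simp)
  have hbb : ⇑bb = ![x, y, e3, e4] := by simp [bb]
  obtain ⟨a, b, c, d, h23⟩ : ∃ a b c d : ℂ, B y e3 = a • x + b • y + c • e3 + d • e4 := by
    have := bb.sum_equivFun (B y e3)
    rw [Fin.sum_univ_four, hbb] at this
    exact ⟨_, _, _, _, this.symm⟩
  have h24 : B y e4 = b • e3 + c • e4 := by
    have h := hj x y e3
    rw [h3, hanti x e3, h4, halt, h23] at h
    simp [halt, h3, h4, hy3] at h
    linear_combination (exp := 1) -h
  have h34 : B e3 e4 = b • e4 := by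
    have h := hj x y e4
    rw [h3, hanti x e4, hy3, h24, hanti e3 e4] at h
    simp [h4, hy3] at h
    linear_combination (exp := 1) -h
  have hb := nilp_eig (hn _) hy2 h34
  subst hb
  have h24' : B y e4 = c • e4 := by simpa using h24
  have hc := nilp_eig (hn _) hy2 h24'
  subst hc
  simp at h23 h24' h34
  have he3 : e3 ≠ 0 := by rintro rfl; simp at h4; exact hy2 h4.symm
  have ha : a = 0 := by
    have h2 : IsNilpotent (B y * B y) := by
      obtain ⟨k, hk⟩ := hn y
      exact ⟨k, by rw [← pow_two, ← pow_mul, mul_comm, pow_mul, hk]; simp⟩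
    have : (B y * B y) e3 = (-a) • e3 := by
      simp [h23, h24', hanti x y, h3]
    have := nilp_eig h2 he3 this
    simpa using this
  subst ha
  simp at h23
  refine orbit_lemma B halt 1 x (y - d • x) e3 e4 (mk _ ?_) ?_ ?_ ?_ ?_ ?_ ?_
  · intro p q r s h
    have h' : (p - q * d) • x + q • y + r • e3 + s • e4 = 0 := by
      rw [← h]; module
    obtain ⟨h1, h2, h3, h4⟩ := hli' _ _ _ _ h'
    subst h2
    exact ⟨by simpa using h1, rfl, h3, h4⟩
  all_goals simp [halt, h3, h4, hy3, h23, h24', h34]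

theorem case_two (B : V 4 →ₗ[ℂ] V 4 →ₗ[ℂ] V 4) (halt : ∀ x, B x x = 0)
    (hj : ∀ x y z, B x (B y z) + B y (B z x) + B z (B x y) = 0)
    (hx : ∀ x v, B x (B x v) = 0) (e1 e2 : V 4) (h12 : B e1 e2 ≠ 0) :
    (fun x y => B x y) ∈ lieOrbit (fam 1 0) := by
  have hanti : ∀ x y, B y x = - B x y := fun x y => by
    have h := halt (x + y)
    simp only [map_add, LinearMap.add_apply, halt, zero_add, add_zero] at h
    exact eq_neg_of_add_eq_zero_left h
  have hs : ∀ x y z, B y (B x z) = - B x (B y z) := fun x y z => by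
    have h := hx (x + y) z
    simp only [map_add, LinearMap.add_apply, hx, zero_add, add_zero] at h
    first
      | exact eq_neg_of_add_eq_zero_left h
      | exact eq_neg_of_add_eq_zero_right h
  have hcen : ∀ x y z, B x (B y z) = 0 := by
    intro x y z
    have h := hj x y z
    rw [hanti x z, map_neg, hs x y z, hs x z y, hanti y z, map_neg] at h
    have h3 : (3 : ℂ) • B x (B y z) = 0 := by
      rw [← h]; module
    simpa using h3
  have hcen' : ∀ x y z, B (B y z) x = 0 := fun x y z => by rw [hanti x, hcen, neg_zero]
  obtain ⟨e3, h3⟩ : ∃ e3, B e1 e2 = e3 := ⟨_, rfl⟩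
  rw [h3] at h12
  have h13 : B e1 e3 = 0 := by rw [← h3]; exact hcen _ _ _
  have h23 : B e2 e3 = 0 := by rw [← h3]; exact hcen _ _ _
  have hli3 : ∀ a b c : ℂ, a • e1 + b • e2 + c • e3 = 0 → a = 0 ∧ b = 0 ∧ c = 0 := by
    intro a b c h
    have hb := congrArg (fun v => B e1 v) h
    simp [halt, h3, h13, h12] at hb
    subst hb
    have ha := congrArg (fun v => B e2 v) h
    simp [halt, hanti e1 e2, h3, h23, h12] at ha
    subst ha
    simpa [h12] using h
  obtain ⟨e4, he4⟩ : ∃ e4, e4 ∉ Submodule.span ℂ (Set.range ![e1, e2, e3]) := by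
    by_contra! hcon
    have htop : Submodule.span ℂ (Set.range ![e1, e2, e3]) = ⊤ := by
      rw [eq_top_iff]; intro v _; exact hcon v
    have := finrank_range_le_card (R := ℂ) ![e1, e2, e3]
    rw [Set.finrank, htop] at this
    simp at this
  have hli' : ∀ a b c d : ℂ, a • e1 + b • e2 + c • e3 + d • e4 = 0 →
      a = 0 ∧ b = 0 ∧ c = 0 ∧ d = 0 := by
    intro a b c d h
    have hd : d = 0 := by
      by_contra hd
      apply he4
      have : e4 = (-a / d) • e1 + (-b / d) • e2 + (-c / d) • e3 := by
        have h2 : d • e4 = (-a) • e1 + (-b) • e2 + (-c) • e3 := by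
          rw [← sub_eq_zero, ← h]; module
        have h5 : e4 = d⁻¹ • (d • e4) := by rw [smul_smul, inv_mul_cancel₀ hd, one_smul]
        rw [h5, h2]; module
      rw [this]
      have m : ∀ i, ![e1, e2, e3] i ∈ Submodule.span ℂ (Set.range ![e1, e2, e3]) :=
        fun i => Submodule.subset_span ⟨i, rfl⟩
      exact Submodule.add_mem _ (Submodule.add_mem _ (Submodule.smul_mem _ _ (m 0))
        (Submodule.smul_mem _ _ (m 1))) (Submodule.smul_mem _ _ (m 2))
    subst hd
    obtain ⟨h1, h2, h3⟩ := hli3 a b c (by simpa using h)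
    exact ⟨h1, h2, h3, rfl⟩
  have mk : ∀ f, (∀ a b c d : ℂ, a • e1 + b • e2 + c • e3 + d • f = 0 →
      a = 0 ∧ b = 0 ∧ c = 0 ∧ d = 0) → LinearIndependent ℂ ![e1, e2, e3, f] := by
    intro f h
    rw [Fintype.linearIndependent_iff]
    intro g hg
    simp [Fin.sum_univ_four] at hg
    obtain ⟨h0, h1, h2, h3⟩ := h _ _ _ _ hg
    intro i; fin_cases i <;> assumption
  let bb : Basis (Fin 4) ℂ (V 4) :=
    basisOfLinearIndependentOfCardEqFinrank (mk e4 hli') (by simp)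
  have hbb : ⇑bb = ![e1, e2, e3, e4] := by simp [bb]
  have hdec : ∀ v, ∃ a b c d : ℂ, v = a • e1 + b • e2 + c • e3 + d • e4 := by
    intro v
    have := bb.sum_equivFun v
    rw [Fin.sum_univ_four, hbb] at this
    exact ⟨_, _, _, _, this.symm⟩
  have h14 : ∃ r : ℂ, B e1 e4 = r • e3 := by
    obtain ⟨p, q, r, s, h⟩ := hdec (B e1 e4)
    have h1 := hcen e1 e1 e4
    rw [h] at h1
    simp only [map_add, map_smul, halt, h3, h13] at h1
    rw [h] at h1
    obtain ⟨-, -, -, h5⟩ := hli' (s * p) (s * q) (q + s * r) (s * s) (by rw [← h1]; module)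
    have hs0 : s = 0 := by simpa using h5
    subst hs0
    simp [h12] at h1
    subst h1
    have h2 := hcen e2 e1 e4
    rw [h] at h2
    simp [halt, hanti e1 e2, h3, h23, h12] at h2
    subst h2
    exact ⟨r, by simpa using h⟩
  have h24 : ∃ r : ℂ, B e2 e4 = r • e3 := by
    obtain ⟨p, q, r, s, h⟩ := hdec (B e2 e4)
    have h1 := hcen e2 e2 e4
    rw [h] at h1
    simp only [map_add, map_smul, halt, hanti e1 e2, h3, h23] at h1
    rw [h] at h1
    obtain ⟨-, -, -, h5⟩ := hli' (s * p) (s * q) (-p + s * r) (s * s) (by rw [← h1]; module)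
    have hs0 : s = 0 := by simpa using h5
    subst hs0
    simp [h12] at h1
    subst h1
    have h2 := hcen e1 e2 e4
    rw [h] at h2
    simp [halt, h3, h13, h12] at h2
    subst h2
    exact ⟨r, by simpa using h⟩
  obtain ⟨r, h14⟩ := h14
  obtain ⟨t, h24⟩ := h24
  have h3v : ∀ v, B e3 v = 0 := fun v => by rw [← h3]; exact hcen' _ _ _
  refine orbit_lemma B halt 0 e1 e2 e3 (e4 - r • e2 + t • e1) (mk _ ?_) h3 ?_ ?_ h23 ?_ (h3v _)
  · intro p q u s h
    have h' : (p + s * t) • e1 + (q - s * r) • e2 + u • e3 + s • e4 = 0 := by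
      rw [← h]; module
    obtain ⟨h1, h2, h3, h4⟩ := hli' _ _ _ _ h'
    subst h4
    exact ⟨by simpa using h1, by simpa using h2, h3, rfl⟩
  · simp [h13]
  · simp [halt, h14, h3]
  · simp [halt, h24, hanti e1 e2, h3]

theorem nilp_orbits : {μ : V 4 → V 4 → V 4 | IsLieLaw μ ∧ IsNilpotentLaw μ} ⊆
    lieOrbit n4Law ∪ lieOrbit n3CLaw ∪ lieOrbit (fun _ _ => (0 : V 4)) := by
  rintro μ ⟨hl, hn⟩
  have hnil := ad_nilp μ hl hn
  by_cases h1 : ∃ x v, lawBil μ hl x (lawBil μ hl x v) ≠ 0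
  · obtain ⟨x, hx⟩ := h1
    left; left
    rw [n4_eq]
    exact case_one (lawBil μ hl) hl.2.2.1 hl.2.2.2 hnil x hx
  push Not at h1
  by_cases h2 : ∃ x y, lawBil μ hl x y ≠ 0
  · obtain ⟨x, y, hxy⟩ := h2
    left; right
    rw [n3_eq]
    exact case_two (lawBil μ hl) hl.2.2.1 hl.2.2.2 h1 x y hxy
  push Not at h2
  right
  refine ⟨LinearEquiv.refl ℂ _, ?_⟩
  funext x y
  simpa [act, lawBil_apply] using h2 x y

theorem stmt9 :
    {μ : V 4 → V 4 → V 4 | IsLieLaw μ ∧ IsNilpotentLaw μ} = closure (lieOrbit n4Law) ∧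
    closure (lieOrbit n4Law)
      = lieOrbit n4Law ∪ lieOrbit n3CLaw ∪ lieOrbit (fun _ _ => (0 : V 4)) := by
  have hA : closure (lieOrbit n4Law) ⊆ {μ : V 4 → V 4 → V 4 | IsLieLaw μ ∧ IsNilpotentLaw μ} :=
    (closure_minimal orbit_good goodSet_closed).trans good_nilp
  exact ⟨Set.Subset.antisymm (nilp_orbits.trans orbits_sub) hA,
    Set.Subset.antisymm (hA.trans nilp_orbits) orbits_sub⟩
end

section
/- Every nilpotent Lie algebra law on ℂ⁵ lies in the closure of the GL_5(ℂ)-orbit of the law 𝔤_{5,6}; that is, 𝒩₅(ℂ) = closure(O(𝔤_{5,6}(ℂ))), where 𝔤_{5,6} is defined on a basis (e₁,…,e₅) by [e₁,e₂] = e₃, [e₁,e₃] = e₄, [e₁,e₄] = e₅, [e₂,e₃] = e₅ (all other basis brackets zero). -/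
open Module Submodule Filter Topology

/-- The law `𝔤_{5,6}` on `ℂ⁵`:
`[e₁,e₂] = e₃`, `[e₁,e₃] = e₄`, `[e₁,e₄] = e₅`, `[e₂,e₃] = e₅`. -/
noncomputable def g56Law : V 5 → V 5 → V 5 := fun x y =>
  ![0, 0,
    x 0 * y 1 - x 1 * y 0,
    x 0 * y 2 - x 2 * y 0,
    (x 0 * y 3 - x 3 * y 0) + (x 1 * y 2 - x 2 * y 1)]

/-- The explicit family of laws. -/
noncomputable def Tlaw (a3 a4 a5 b4 b5 c5 d5 : ℂ) : V 5 → V 5 → V 5 := fun x y =>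
  ![0, 0,
    a3 * (x 0 * y 1 - x 1 * y 0),
    a4 * (x 0 * y 1 - x 1 * y 0) + b4 * (x 0 * y 2 - x 2 * y 0),
    a5 * (x 0 * y 1 - x 1 * y 0) + b5 * (x 0 * y 2 - x 2 * y 0)
      + c5 * (x 0 * y 3 - x 3 * y 0) + d5 * (x 1 * y 2 - x 2 * y 1)]

theorem Tlaw_g56 : Tlaw 1 0 0 1 0 1 1 = g56Law := by
  funext x y; ext i; fin_cases i <;> simp [Tlaw, g56Law]

/-- Independence of five vectors in explicit form. -/
def Ind (e1 e2 e3 e4 e5 : V 5) : Prop :=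
  ∀ c1 c2 c3 c4 c5 : ℂ, c1 • e1 + c2 • e2 + c3 • e3 + c4 • e4 + c5 • e5 = 0 →
    c1 = 0 ∧ c2 = 0 ∧ c3 = 0 ∧ c4 = 0 ∧ c5 = 0

/-- A good basis for the alternating bilinear map `M`. -/
def Good (M : V 5 →ₗ[ℂ] V 5 →ₗ[ℂ] V 5) (a3 a4 a5 b4 b5 c5 d5 : ℂ) (e1 e2 e3 e4 e5 : V 5) : Prop :=
  Ind e1 e2 e3 e4 e5 ∧ M e1 e2 = a3 • e3 + a4 • e4 + a5 • e5 ∧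
    M e1 e3 = b4 • e4 + b5 • e5 ∧ M e1 e4 = c5 • e5 ∧ M e1 e5 = 0 ∧
    M e2 e3 = d5 • e5 ∧ M e2 e4 = 0 ∧ M e2 e5 = 0 ∧ M e3 e4 = 0 ∧ M e3 e5 = 0 ∧ M e4 e5 = 0

theorem Ind.equiv {e1 e2 e3 e4 e5 : V 5} (h : Ind e1 e2 e3 e4 e5) :
    ∃ g : V 5 ≃ₗ[ℂ] V 5, ∀ x, g x = x 0 • e1 + x 1 • e2 + x 2 • e3 + x 3 • e4 + x 4 • e5 := by
  let L : V 5 →ₗ[ℂ] V 5 := Fintype.linearCombination ℂ ![e1, e2, e3, e4, e5]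
  have hL : ∀ x, L x = x 0 • e1 + x 1 • e2 + x 2 • e3 + x 3 • e4 + x 4 • e5 := by
    intro x
    simp [L, Fintype.linearCombination_apply, Fin.sum_univ_five]
  have inj : Function.Injective L := by
    rw [← LinearMap.ker_eq_bot, LinearMap.ker_eq_bot']
    intro x hx
    rw [hL] at hx
    obtain ⟨h0, h1, h2, h3, h4⟩ := h _ _ _ _ _ hx
    ext i; fin_cases i <;> simpa
  exact ⟨LinearEquiv.ofInjectiveEndo L inj, fun x => by simpa using hL x⟩

theorem Good.rep {M : V 5 →ₗ[ℂ] V 5 →ₗ[ℂ] V 5} (alt : ∀ x, M x x = 0)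
    {a3 a4 a5 b4 b5 c5 d5 : ℂ} {e1 e2 e3 e4 e5 : V 5}
    (h : Good M a3 a4 a5 b4 b5 c5 d5 e1 e2 e3 e4 e5) :
    ∃ g : V 5 ≃ₗ[ℂ] V 5, (fun x y => M x y) = act g (Tlaw a3 a4 a5 b4 b5 c5 d5) := by
  obtain ⟨hi, h12, h13, h14, h15, h23, h24, h25, h34, h35, h45⟩ := h
  obtain ⟨g, hg⟩ := hi.equiv
  have sk : ∀ x y, M y x = - M x y := by
    intro x y
    have := alt (x + y)
    simp only [map_add, LinearMap.add_apply, alt] at this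
    rw [eq_neg_iff_add_eq_zero]
    simpa [add_comm] using this
  refine ⟨g, ?_⟩
  funext x y
  obtain ⟨x, rfl⟩ := g.surjective x
  obtain ⟨y, rfl⟩ := g.surjective y
  simp only [act, LinearEquiv.symm_apply_apply]
  rw [hg x, hg y, hg]
  simp only [map_add, LinearMap.add_apply, map_smul, LinearMap.smul_apply, alt,
    sk e1 e2, sk e1 e3, sk e1 e4, sk e1 e5, sk e2 e3, sk e2 e4, sk e2 e5, sk e3 e4, sk e3 e5,
    sk e4 e5, h12, h13, h14, h15, h23, h24, h25, h34, h35, h45]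
  simp [Tlaw]
  module

theorem act_act {n : ℕ} (g h : V n ≃ₗ[ℂ] V n) (μ : V n → V n → V n) :
    act g (act h μ) = act (h.trans g) μ := by
  funext x y; simp [act]

theorem Tlaw_lin (a3 a4 a5 b4 b5 c5 d5 : ℂ) : ∃ M : V 5 →ₗ[ℂ] V 5 →ₗ[ℂ] V 5,
    ∀ x y, M x y = Tlaw a3 a4 a5 b4 b5 c5 d5 x y := by
  refine ⟨LinearMap.mk₂ ℂ (Tlaw a3 a4 a5 b4 b5 c5 d5) ?_ ?_ ?_ ?_, fun x y => rfl⟩ <;>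
  · intros; ext i; fin_cases i <;> simp [Tlaw] <;> ring

theorem Tlaw_alt (a3 a4 a5 b4 b5 c5 d5 : ℂ) (x : V 5) : Tlaw a3 a4 a5 b4 b5 c5 d5 x x = 0 := by
  ext i; fin_cases i <;> simp [Tlaw, mul_comm]

theorem Tlaw_orbit {a3 a4 a5 b4 b5 c5 d5 : ℂ} (ha : a3 ≠ 0) (hb : b4 ≠ 0) (hc : c5 ≠ 0)
    (hd : d5 ≠ 0) : ∃ g, Tlaw a3 a4 a5 b4 b5 c5 d5 = act g g56Law := by
  obtain ⟨M, hM⟩ := Tlaw_lin a3 a4 a5 b4 b5 c5 d5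
  have alt : ∀ x, M x x = 0 := fun x => by rw [hM, Tlaw_alt]
  have e : (fun x y => M x y) = Tlaw a3 a4 a5 b4 b5 c5 d5 := by funext x y; exact hM x y
  obtain ⟨t, ht0, ht⟩ : ∃ t : ℂ, t ≠ 0 ∧ t * d5 = b4 * c5 :=
    ⟨b4 * c5 / d5, by positivity, by field_simp⟩
  rw [← e, ← Tlaw_g56]
  apply Good.rep alt (e1 := ![1, 0, 0, 0, 0]) (e2 := ![0, t, 0, 0, 0])
    (e3 := ![0, 0, t * a3, t * a4, t * a5])
    (e4 := ![0, 0, 0, t * (a3 * b4), t * (a3 * b5 + a4 * c5)])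
    (e5 := ![0, 0, 0, 0, t * (a3 * b4 * c5)])
  refine ⟨?_, ?_, ?_, ?_, ?_, ?_, ?_, ?_, ?_, ?_, ?_⟩
  · intro c1 c2 c3 c4 c6 h
    have h0 := congrFun h 0
    have h1 := congrFun h 1
    have h2 := congrFun h 2
    have h3 := congrFun h 3
    have h4 := congrFun h 4
    simp [ht0, ha, hb, hc] at h0 h1 h2 h3 h4
    subst h0 h1 h2
    simp [ht0, ha, hb, hc] at h3
    subst h3
    simp [ht0, ha, hb, hc] at h4
    simp [h4]
  all_goals
    rw [hM]; ext i; fin_cases i <;> simp [Tlaw]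
  all_goals first | ring | skip
  linear_combination t * a3 * ht

theorem ev_ne (a : ℂ) : ∀ᶠ s in 𝓝[≠] (0 : ℂ), a + s ≠ 0 := by
  by_cases ha : a = 0
  · subst ha
    filter_upwards [self_mem_nhdsWithin] with s hs
    simpa using hs
  · apply eventually_nhdsWithin_of_eventually_nhds
    have : ContinuousAt (fun s : ℂ => a + s) 0 := by fun_prop
    exact this.eventually_ne (by simpa using ha)

theorem Good.closure {M : V 5 →ₗ[ℂ] V 5 →ₗ[ℂ] V 5} (alt : ∀ x, M x x = 0)
    {a3 a4 a5 b4 b5 c5 d5 : ℂ} {e1 e2 e3 e4 e5 : V 5}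
    (h : Good M a3 a4 a5 b4 b5 c5 d5 e1 e2 e3 e4 e5) :
    (fun x y => M x y) ∈ closure (lieOrbit g56Law) := by
  obtain ⟨g, hg⟩ := h.rep alt
  rw [hg]
  have cont : Continuous (fun s : ℂ =>
      act g (Tlaw (a3 + s) a4 a5 (b4 + s) b5 (c5 + s) (d5 + s))) := by
    refine continuous_pi fun x => continuous_pi fun y => ?_
    unfold act
    refine (LinearMap.continuous_of_finiteDimensional (g : V 5 →ₗ[ℂ] V 5)).comp ?_
    refine continuous_pi fun i => ?_
    fin_cases i <;> simp [Tlaw] <;> fun_prop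
  have tt := (cont.tendsto 0).mono_left (nhdsWithin_le_nhds (s := {0}ᶜ))
  simp only [add_zero] at tt
  refine mem_closure_of_tendsto tt ?_
  filter_upwards [ev_ne a3, ev_ne b4, ev_ne c5, ev_ne d5] with s h1 h2 h3 h4
  obtain ⟨k, hk⟩ := Tlaw_orbit (a4 := a4) (a5 := a5) (b5 := b5) h1 h2 h3 h4
  exact ⟨k.trans g, by rw [hk, act_act]⟩

theorem caseA {M : V 5 →ₗ[ℂ] V 5 →ₗ[ℂ] V 5} (alt : ∀ x, M x x = 0)
    {a3 a4 a5 b4 b5 c5 d4 d5 f5 : ℂ} {e1 e2 e3 e4 e5 : V 5} (hi : Ind e1 e2 e3 e4 e5)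
    (h12 : M e1 e2 = a3 • e3 + a4 • e4 + a5 • e5)
    (h13 : M e1 e3 = b4 • e4 + b5 • e5) (h14 : M e1 e4 = c5 • e5)
    (h23 : M e2 e3 = d4 • e4 + d5 • e5) (h24 : M e2 e4 = f5 • e5) (h34 : M e3 e4 = 0)
    (h5 : ∀ y, M y e5 = 0) (hJ : b4 * f5 = d4 * c5) :
    (fun x y => M x y) ∈ closure (lieOrbit g56Law) := by
  have sk : ∀ x y, M y x = - M x y := by
    intro x y
    have := alt (x + y)
    simp only [map_add, LinearMap.add_apply, alt] at this
    rw [eq_neg_iff_add_eq_zero]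
    simpa [add_comm] using this
  by_cases h0 : d4 = 0 ∧ f5 = 0
  · obtain ⟨rfl, rfl⟩ := h0
    refine Good.closure (a3 := a3) (a4 := a4) (a5 := a5) (b4 := b4) (b5 := b5) (c5 := c5) (d5 := d5)
      (e1 := e1) (e2 := e2) (e3 := e3) (e4 := e4) (e5 := e5) alt
      ⟨hi, h12, h13, h14, h5 _, ?_, ?_, h5 _, h34, h5 _, h5 _⟩
    · rw [h23]; simp
    · rw [h24]; simp
  · obtain ⟨q, hq1, hq2⟩ : ∃ q : ℂ, b4 + q * d4 = 0 ∧ c5 + q * f5 = 0 := by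
      by_cases hd : d4 = 0
      · have hf : f5 ≠ 0 := fun hf => h0 ⟨hd, hf⟩
        refine ⟨-c5 / f5, ?_, ?_⟩
        · subst hd
          have : b4 = 0 := by simpa [hf] using hJ
          simp [this]
        · field_simp; ring
      · refine ⟨-b4 / d4, ?_, ?_⟩
        · field_simp; ring
        · field_simp; linear_combination -hJ
    refine Good.closure (a3 := -a3) (a4 := -a4) (a5 := -a5) (b4 := d4) (b5 := d5) (c5 := f5)
      (d5 := b5 + q * d5)
      (e1 := e2) (e2 := e1 + q • e2) (e3 := e3) (e4 := e4) (e5 := e5) alt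
      ⟨?_, ?_, h23, h24, h5 _, ?_, ?_, h5 _, h34, h5 _, h5 _⟩
    · intro c1 c2 c3 c4 c6 h
      obtain ⟨k1, k2, k3, k4, k5⟩ := hi c2 (c1 + q * c2) c3 c4 c6 (by rw [← h]; module)
      subst k1
      simp at k2
      exact ⟨k2, rfl, k3, k4, k5⟩
    · simp only [map_add, map_smul, alt, sk e1 e2, h12]; module
    · simp only [map_add, map_smul, LinearMap.add_apply, LinearMap.smul_apply, h13, h23]
      linear_combination (norm := module) hq1 • e4
    · simp only [map_add, map_smul, LinearMap.add_apply, LinearMap.smul_apply, h14, h24]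
      linear_combination (norm := module) hq2 • e5

theorem mainFlag {M : V 5 →ₗ[ℂ] V 5 →ₗ[ℂ] V 5} (alt : ∀ x, M x x = 0)
    (jac : ∀ x y z, M x (M y z) + M y (M z x) + M z (M x y) = 0)
    {a3 a4 a5 b4 b5 c5 d4 d5 f5 g5 : ℂ} {e1 e2 e3 e4 e5 : V 5} (hi : Ind e1 e2 e3 e4 e5)
    (h12 : M e1 e2 = a3 • e3 + a4 • e4 + a5 • e5)
    (h13 : M e1 e3 = b4 • e4 + b5 • e5) (h14 : M e1 e4 = c5 • e5)
    (h23 : M e2 e3 = d4 • e4 + d5 • e5) (h24 : M e2 e4 = f5 • e5) (h34 : M e3 e4 = g5 • e5)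
    (h5 : ∀ y, M y e5 = 0) :
    (fun x y => M x y) ∈ closure (lieOrbit g56Law) := by
  have sk : ∀ x y, M y x = - M x y := by
    intro x y
    have := alt (x + y)
    simp only [map_add, LinearMap.add_apply, alt] at this
    rw [eq_neg_iff_add_eq_zero]
    simpa [add_comm] using this
  have J1 : a3 * g5 = 0 := by
    have := jac e1 e2 e4
    simp only [sk e1 e4, h12, h14, h24, map_add, map_neg, map_smul, h5, sk e3 e4, alt,
      h34] at this
    have := (hi 0 0 0 0 (-(a3 * g5)) (by rw [← this]; module)).2.2.2.2
    simpa using this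
  have J2 : b4 * f5 = d4 * c5 + a4 * g5 := by
    have := jac e1 e2 e3
    simp only [sk e1 e3, h12, h13, h14, h24, h23, map_add, map_neg, map_smul, h5, sk e3 e4, alt,
      h34] at this
    have := (hi 0 0 0 0 (d4 * c5 + a4 * g5 - b4 * f5) (by rw [← this]; module)).2.2.2.2
    linear_combination -this
  by_cases hg : g5 = 0
  · subst hg
    exact caseA alt hi h12 h13 h14 h23 h24 (by simpa using h34) h5 (by simpa using J2)
  have ha : a3 = 0 := by simpa [hg] using J1
  subst ha
  have key : M e4 (d4 • e1 - b4 • e2 + a4 • e3) = 0 := by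
    simp only [map_add, map_sub, map_smul, sk e1 e4, sk e2 e4, sk e3 e4, h14, h24, h34]
    linear_combination (norm := module) J2 • e5
  by_cases h4 : a4 = 0
  · subst h4
    by_cases hb : b4 = 0
    · subst hb
      by_cases hd : d4 = 0
      · subst hd
        refine Good.closure (a3 := 0) (a4 := 0) (a5 := -b5) (b4 := 0) (b5 := -d5) (c5 := g5)
          (d5 := a5 + (-f5 / g5) * b5 + (-c5 / g5) * (-d5))
          (e1 := e3) (e2 := e1 + (-c5 / g5) • e3) (e3 := e2 + (-f5 / g5) • e3)
          (e4 := e4) (e5 := e5) alt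
          ⟨?_, ?_, ?_, h34, h5 _, ?_, ?_, h5 _, ?_, h5 _, h5 _⟩
        · intro c1 c2 c3 c4 c6 h
          obtain ⟨k1, k2, k3, k4, k5⟩ := hi c2 c3 (c1 + (-c5 / g5) * c2 + (-f5 / g5) * c3) c4 c6
            (by rw [← h]; module)
          subst k1 k2
          simp at k3
          exact ⟨k3, rfl, rfl, k4, k5⟩
        · simp only [map_add, map_smul, alt, sk e1 e3, h13]; module
        · simp only [map_add, map_smul, alt, sk e2 e3, h23]; module
        · simp only [map_add, map_smul, LinearMap.add_apply, LinearMap.smul_apply, alt, sk e2 e3,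
            h12, h13, h23]; module
        · simp only [map_add, map_smul, LinearMap.add_apply, LinearMap.smul_apply, h14, h34]
          rw [smul_smul, ← add_smul]; field_simp; simp
        · simp only [map_add, map_smul, LinearMap.add_apply, LinearMap.smul_apply, h24, h34]
          rw [smul_smul, ← add_smul]; field_simp; simp
      · refine caseA (a3 := d4) (a4 := 0) (a5 := d5) (b4 := 0) (b5 := f5)
          (c5 := -d4 * a5) (d4 := 0) (d5 := g5) (f5 := -d4 * b5)
          (e1 := e2) (e2 := e3) (e3 := e4) (e4 := d4 • e1 - (0 : ℂ) • e2 + (0 : ℂ) • e3) (e5 := e5)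
          alt ?_ ?_ ?_ ?_ ?_ ?_ key h5 (by simp)
        · intro c1 c2 c3 c4 c6 h
          obtain ⟨k1, k2, k3, k4, k5⟩ := hi (c4 * d4) c1 c2 c3 c6 (by rw [← h]; module)
          simp [hd] at k1
          exact ⟨k2, k3, k4, k1, k5⟩
        · rw [h23]; module
        · rw [h24]; module
        · simp only [map_add, map_sub, map_smul, alt, sk e1 e2, h12, h23]; module
        · rw [h34]; module
        · simp only [map_add, map_sub, map_smul, alt, sk e1 e3, sk e2 e3, h13, h23]; module
    · refine caseA (a3 := b4) (a4 := 0) (a5 := b5) (b4 := 0) (b5 := c5)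
          (c5 := -b4 * a5) (d4 := 0) (d5 := g5) (f5 := b4 * d5 - d4 * b5)
          (e1 := e1) (e2 := e3) (e3 := e4) (e4 := d4 • e1 - b4 • e2 + (0 : ℂ) • e3) (e5 := e5)
          alt ?_ ?_ ?_ ?_ ?_ ?_ key h5 (by simp)
      · intro c1 c2 c3 c4 c6 h
        obtain ⟨k1, k2, k3, k4, k5⟩ := hi (c1 + c4 * d4) (-(c4 * b4)) c2 c3 c6
          (by rw [← h]; module)
        simp [hb] at k2
        subst k2
        simp at k1
        exact ⟨k1, k3, k4, rfl, k5⟩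
      · rw [h13]; module
      · rw [h14]; module
      · simp only [map_add, map_sub, map_smul, alt, h12, h13]; module
      · rw [h34]; module
      · simp only [map_add, map_sub, map_smul, alt, sk e1 e3, sk e2 e3, h13, h23]; module
  · refine caseA (a3 := a4) (a4 := 0) (a5 := a5) (b4 := 0) (b5 := c5)
          (c5 := -b4 * a5 + a4 * b5) (d4 := 0) (d5 := f5) (f5 := a4 * d5 - d4 * a5)
          (e1 := e1) (e2 := e2) (e3 := e4) (e4 := d4 • e1 - b4 • e2 + a4 • e3) (e5 := e5)
          alt ?_ ?_ ?_ ?_ ?_ ?_ key h5 (by simp)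
    · intro c1 c2 c3 c4 c6 h
      obtain ⟨k1, k2, k3, k4, k5⟩ := hi (c1 + c4 * d4) (c2 - c4 * b4) (c4 * a4) c3 c6
        (by rw [← h]; module)
      simp [h4] at k3
      subst k3
      simp at k1 k2
      exact ⟨k1, k2, k4, rfl, k5⟩
    · rw [h12]; module
    · rw [h14]; module
    · simp only [map_add, map_sub, map_smul, alt, h12, h13]; module
    · rw [h24]; module
    · simp only [map_add, map_sub, map_smul, alt, sk e1 e2, h12, h23]; module

theorem flag_step {μ : V 5 → V 5 → V 5} (hn : IsNilpotentLaw μ) {n : ℕ} (hn5 : n < 5)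
    (v : Fin n → V 5) (hv : LinearIndependent ℂ v) :
    ∃ x, LinearIndependent ℂ (Fin.cons x v : Fin (n + 1) → V 5) ∧
      ∀ y, μ y x ∈ Submodule.span ℂ (Set.range v) := by
  classical
  set W := Submodule.span ℂ (Set.range v) with hW
  have hWt : W ≠ ⊤ := by
    intro h
    have h1 := finrank_range_le_card (R := ℂ) v
    rw [Set.finrank, ← hW, h, finrank_top] at h1
    simp at h1
    omega
  have hex : ∃ k, lcs μ k ≤ W := by
    obtain ⟨k, hk⟩ := hn
    exact ⟨k, by rw [hk]; exact bot_le⟩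
  obtain ⟨k, hk, hmin⟩ : ∃ k, lcs μ k ≤ W ∧ ∀ j < k, ¬ lcs μ j ≤ W :=
    ⟨Nat.find hex, Nat.find_spec hex, fun j hj => Nat.find_min hex hj⟩
  cases k with
  | zero => exact absurd (top_le_iff.mp hk) hWt
  | succ k =>
    obtain ⟨x, hx, hxW⟩ := SetLike.not_le_iff_exists.mp (hmin k (Nat.lt_succ_self k))
    exact ⟨x, linearIndependent_finCons.mpr ⟨hv, hxW⟩,
      fun y => hk (Submodule.subset_span ⟨y, x, hx, rfl⟩)⟩

theorem subset_dir {μ : V 5 → V 5 → V 5} (h : IsLieLaw μ) (hn : IsNilpotentLaw μ) :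
    μ ∈ closure (lieOrbit g56Law) := by
  obtain ⟨l1, l2, alt, jac⟩ := h
  have z1 : ∀ z, μ 0 z = 0 := fun z => by simpa using l1 1 0 0 z
  have z2 : ∀ z, μ z 0 = 0 := fun z => by simpa using l2 1 z 0 0
  obtain ⟨M, hM⟩ : ∃ M : V 5 →ₗ[ℂ] V 5 →ₗ[ℂ] V 5, μ = fun x y => M x y :=
    ⟨LinearMap.mk₂ ℂ μ (fun x y z => by simpa using l1 1 x y z)
      (fun c x y => by simpa [z1] using l1 c x 0 y)
      (fun x y z => by simpa using l2 1 x y z)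
      (fun c x y => by simpa [z2] using l2 c x y 0), rfl⟩
  obtain ⟨e5, i5, p5⟩ := flag_step hn (n := 0) (by norm_num) ![] linearIndependent_empty_type
  obtain ⟨e4, i4, p4⟩ := flag_step hn (by norm_num) _ i5
  obtain ⟨e3, i3, p3⟩ := flag_step hn (by norm_num) _ i4
  obtain ⟨e2, i2, p2⟩ := flag_step hn (by norm_num) _ i3
  obtain ⟨e1, i1, -⟩ := flag_step hn (by norm_num) _ i2
  subst hM
  have hi : Ind e1 e2 e3 e4 e5 := by
    intro c1 c2 c3 c4 c5 hc
    have := Fintype.linearIndependent_iff.mp i1 ![c1, c2, c3, c4, c5]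
      (by rw [← hc, Fin.sum_univ_five]; rfl)
    exact ⟨this 0, this 1, this 2, this 3, this 4⟩
  have q5 : ∀ y, M y e5 = 0 := by
    intro y; simpa using p5 y
  have q4 : ∀ y, ∃ c : ℂ, M y e4 = c • e5 := by
    intro y
    obtain ⟨c, hc⟩ := (Submodule.mem_span_range_iff_exists_fun ℂ).mp (p4 y)
    exact ⟨c 0, hc.symm.trans (by simp)⟩
  have q3 : ∀ y, ∃ c d : ℂ, M y e3 = c • e4 + d • e5 := by
    intro y
    obtain ⟨c, hc⟩ := (Submodule.mem_span_range_iff_exists_fun ℂ).mp (p3 y)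
    exact ⟨c 0, c 1, hc.symm.trans (by rw [Fin.sum_univ_two]; rfl)⟩
  have q2 : ∀ y, ∃ b c d : ℂ, M y e2 = b • e3 + c • e4 + d • e5 := by
    intro y
    obtain ⟨c, hc⟩ := (Submodule.mem_span_range_iff_exists_fun ℂ).mp (p2 y)
    exact ⟨c 0, c 1, c 2, hc.symm.trans (by rw [Fin.sum_univ_three]; rfl)⟩
  obtain ⟨_, _, _, h12⟩ := q2 e1
  obtain ⟨_, _, h13⟩ := q3 e1
  obtain ⟨_, _, h23⟩ := q3 e2
  obtain ⟨_, h14⟩ := q4 e1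
  obtain ⟨_, h24⟩ := q4 e2
  obtain ⟨_, h34⟩ := q4 e3
  exact mainFlag alt jac hi h12 h13 h14 h23 h24 h34 q5

/-- Linear extension in the second variable. -/
noncomputable def Bx (μ : V 5 → V 5 → V 5) (x w : V 5) : V 5 :=
  ∑ i, w i • μ x (Pi.single i 1)

/-- The closed conditions satisfied on the orbit. -/
def ClosedCond (μ : V 5 → V 5 → V 5) : Prop :=
  (∀ (a : ℂ) (x y z : V 5), μ (a • x + y) z = a • μ x z + μ y z) ∧
  (∀ (a : ℂ) (x y z : V 5), μ x (a • y + z) = a • μ x y + μ x z) ∧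
  (∀ x : V 5, μ x x = 0) ∧
  (∀ x y z : V 5, Bx μ x (μ y z) + Bx μ y (μ z x) + Bx μ z (μ x y) = 0) ∧
  (∀ x y z u v : V 5, Bx μ x (Bx μ y (Bx μ z (μ u v))) = 0)

theorem Bx_eq {μ : V 5 → V 5 → V 5}
    (l2 : ∀ (a : ℂ) (x y z : V 5), μ x (a • y + z) = a • μ x y + μ x z) (x w : V 5) :
    Bx μ x w = μ x w := by
  have z2 : ∀ z, μ z 0 = 0 := fun z => by simpa using l2 1 z 0 0
  let L : V 5 →ₗ[ℂ] V 5 :=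
    { toFun := μ x
      map_add' := fun y z => by simpa using l2 1 x y z
      map_smul' := fun c y => by simpa [z2] using l2 c x y 0 }
  change _ = L w
  rw [LinearMap.pi_apply_eq_sum_univ L w]
  unfold Bx
  refine Finset.sum_congr rfl fun i _ => ?_
  change w i • L _ = _
  congr 2
  ext j
  simp [Pi.single_apply, eq_comm]

theorem Bx_cont {f : (V 5 → V 5 → V 5) → V 5} (hf : Continuous f) (x : V 5) :
    Continuous (fun μ => Bx μ x (f μ)) := by
  unfold Bx
  fun_prop

theorem isClosed_cond : IsClosed {μ | ClosedCond μ} := by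
  have ev : ∀ x y : V 5, Continuous (fun μ : V 5 → V 5 → V 5 => μ x y) := fun x y => by fun_prop
  unfold ClosedCond
  simp only [Set.ofPred_and, Set.ofPred_forall]
  refine IsClosed.inter ?_ (IsClosed.inter ?_ (IsClosed.inter ?_ (IsClosed.inter ?_ ?_)))
  · refine isClosed_iInter fun a => isClosed_iInter fun x => isClosed_iInter fun y =>
      isClosed_iInter fun z => isClosed_eq (ev _ _) (((ev _ _).const_smul a).add (ev _ _))
  · refine isClosed_iInter fun a => isClosed_iInter fun x => isClosed_iInter fun y =>
      isClosed_iInter fun z => isClosed_eq (ev _ _) (((ev _ _).const_smul a).add (ev _ _))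
  · exact isClosed_iInter fun x => isClosed_eq (ev _ _) continuous_const
  · refine isClosed_iInter fun x => isClosed_iInter fun y =>
      isClosed_iInter fun z => isClosed_eq ?_ continuous_const
    exact ((Bx_cont (ev _ _) _).add (Bx_cont (ev _ _) _)).add (Bx_cont (ev _ _) _)
  · refine isClosed_iInter fun x => isClosed_iInter fun y => isClosed_iInter fun z =>
      isClosed_iInter fun u => isClosed_iInter fun v => isClosed_eq ?_ continuous_const
    exact Bx_cont (Bx_cont (Bx_cont (ev _ _) _) _) _

theorem orbit_cond {μ : V 5 → V 5 → V 5} (h : μ ∈ lieOrbit g56Law) : ClosedCond μ := by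
  obtain ⟨g, rfl⟩ := h
  have l1 : ∀ (a : ℂ) (x y z : V 5),
      g56Law (a • x + y) z = a • g56Law x z + g56Law y z := by
    intro a x y z; ext i; fin_cases i <;> simp [g56Law] <;> ring
  have l2 : ∀ (a : ℂ) (x y z : V 5),
      g56Law x (a • y + z) = a • g56Law x y + g56Law x z := by
    intro a x y z; ext i; fin_cases i <;> simp [g56Law] <;> ring
  have k2 : ∀ (a : ℂ) (x y z : V 5),
      act g g56Law x (a • y + z) = a • act g g56Law x y + act g g56Law x z := by
    intro a x y z; simp [act, l2]
  refine ⟨?_, k2, ?_, ?_, ?_⟩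
  · intro a x y z; simp [act, l1]
  · intro x
    have : g56Law (g.symm x) (g.symm x) = 0 := by
      ext i; fin_cases i <;> simp [g56Law] <;> ring
    simp [act, this]
  · intro x y z
    simp only [Bx_eq k2]
    simp only [act, LinearEquiv.symm_apply_apply, ← map_add]
    rw [LinearEquiv.map_eq_zero_iff]
    ext i; fin_cases i <;> simp [g56Law] <;> ring
  · intro x y z u v
    simp only [Bx_eq k2]
    simp only [act, LinearEquiv.symm_apply_apply]
    rw [LinearEquiv.map_eq_zero_iff]
    ext i; fin_cases i <;> simp [g56Law]

theorem lcs_step {μ : V 5 → V 5 → V 5} {k : ℕ} (N : Submodule ℂ (V 5))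
    (h : ∀ x, ∀ y ∈ lcs μ k, μ x y ∈ N) : lcs μ (k + 1) ≤ N := by
  rw [lcs, Submodule.span_le]
  rintro _ ⟨x, y, hy, rfl⟩
  exact h x y hy

theorem cond_good {μ : V 5 → V 5 → V 5} (h : ClosedCond μ) :
    IsLieLaw μ ∧ IsNilpotentLaw μ := by
  obtain ⟨l1, l2, alt, jac, nil⟩ := h
  simp only [Bx_eq l2] at jac nil
  refine ⟨⟨l1, l2, alt, jac⟩, 4, ?_⟩
  have z2 : ∀ z, μ z 0 = 0 := fun z => by simpa using l2 1 z 0 0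
  have ad : ∀ x y z, μ x (y + z) = μ x y + μ x z := fun x y z => by simpa using l2 1 x y z
  have sm : ∀ (c : ℂ) x y, μ x (c • y) = c • μ x y := fun c x y => by simpa [z2] using l2 c x y 0
  -- preimage of a submodule under all left multiplications
  let K : Submodule ℂ (V 5) → Submodule ℂ (V 5) := fun N =>
    { carrier := {w | ∀ x, μ x w ∈ N}
      zero_mem' := fun x => by rw [z2]; exact N.zero_mem
      add_mem' := fun {a b} ha hb x => by rw [ad]; exact N.add_mem (ha x) (hb x)
      smul_mem' := fun c a ha x => by rw [sm]; exact N.smul_mem c (ha x) }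
  have s1 : lcs μ 1 ≤ K (K (K ⊥)) := lcs_step _ fun u v _ => by
    intro z y x
    exact (Submodule.mem_bot ℂ).mpr (nil x y z u v)
  have s2 : lcs μ 2 ≤ K (K ⊥) := lcs_step _ fun x y hy => s1 hy x
  have s3 : lcs μ 3 ≤ K ⊥ := lcs_step _ fun x y hy => s2 hy x
  have s4 : lcs μ 4 ≤ ⊥ := lcs_step _ fun x y hy => s3 hy x
  exact le_bot_iff.mp s4

theorem stmt10 :
    {μ : V 5 → V 5 → V 5 | IsLieLaw μ ∧ IsNilpotentLaw μ} = closure (lieOrbit g56Law) := by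
  apply Set.Subset.antisymm
  · rintro μ ⟨h1, h2⟩
    exact subset_dir h1 h2
  · intro μ h
    exact cond_good (closure_minimal (fun ν hν => orbit_cond hν) isClosed_cond h)
end
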